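/- arXiv:1909.01038 — 2 statements merged into one kernel-verified Lean document; each statement's English description precedes it below -/
import Mathlib

section
/- Let u : Q → P be a homomorphism of commutative (additive) monoids such that P is finitely generated and u is of Kummer type, meaning that for every p ∈ P there exists a positive integer n with n • p lying in the image of u. Then the integral monoid algebra ℤ[P] is a finitely generated module over ℤ[Q], where the module structure is given by the ring homomorphism ℤ[Q] → ℤ[P] induced by u. -/
namespace AddMonoidAlgebra

/-- If every element of `P` has a positive multiple in the image of `u : Q →+ P`, then `R[P]` is
integral over `R[Q]`. -/
theorem mapDomainRingHom_isIntegral {R Q P : Type*} [CommRing R] [AddCommMonoid Q]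
    [AddCommMonoid P] (u : Q →+ P) (hu : ∀ p : P, ∃ n : ℕ, 0 < n ∧ n • p ∈ Set.range u) :
    (mapDomainRingHom R u).IsIntegral := by
  intro x
  induction x using AddMonoidAlgebra.induction_linear with
  | zero => exact RingHom.isIntegralElem_zero _
  | add f g hf hg => exact hf.add _ hg
  | single p r =>
    obtain ⟨n, hn, q, hq⟩ := hu p
    let := (mapDomainRingHom R u).toAlgebra
    refine IsIntegral.of_pow (R := AddMonoidAlgebra R Q) hn ?_
    have h : (single p r : AddMonoidAlgebra R P) ^ n =
        mapDomainRingHom R u (single q (r ^ n)) := by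
      simp [single_pow, hq]
    rw [h]
    exact RingHom.isIntegralElem_map _

end AddMonoidAlgebra

/-- If `u : Q → P` is a homomorphism of commutative additive monoids of Kummer type
(every `p ∈ P` has a positive multiple in the image of `u`) and `P` is finitely
generated, then `ℤ[P]` is a finite module over `ℤ[Q]` via the induced ring
homomorphism `ℤ[Q] → ℤ[P]`. -/
theorem monoidAlgebra_finite_of_kummer {Q P : Type*} [AddCommMonoid Q] [AddCommMonoid P]
    [AddMonoid.FG P] (u : Q →+ P)
    (hu : ∀ p : P, ∃ n : ℕ, 0 < n ∧ n • p ∈ Set.range u) :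
    (AddMonoidAlgebra.mapDomainRingHom ℤ u).Finite := by
  refine (AddMonoidAlgebra.mapDomainRingHom_isIntegral u hu).to_finite ?_
  refine RingHom.FiniteType.of_comp_finiteType (f := algebraMap ℤ (AddMonoidAlgebra ℤ Q)) ?_
  rw [AddMonoidAlgebra.mapDomainRingHom_comp_algebraMap, RingHom.finiteType_algebraMap]
  infer_instance
end

section
/- Let u : Q → P be an injective homomorphism of commutative (additive) monoids of Kummer type, i.e. for every p ∈ P there exists a positive integer n with n • p lying in the image of u. Then the induced ring homomorphism ℤ[Q] → ℤ[P] between monoid algebras is injective and integral, and consequently the induced map on prime spectra Spec ℤ[P] → Spec ℤ[Q] is surjective. -/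
/-- A homomorphism of commutative monoids such that every element of the target has a positive
multiple in its range induces an integral homomorphism of monoid algebras. -/
theorem AddMonoidAlgebra.mapDomainRingHom_isIntegral_s2 {R Q P : Type*} [CommRing R]
    [AddCommMonoid Q] [AddCommMonoid P] (u : Q →+ P)
    (hu : ∀ p : P, ∃ n : ℕ, 0 < n ∧ n • p ∈ Set.range u) :
    (AddMonoidAlgebra.mapDomainRingHom R u).IsIntegral := by
  algebraize [AddMonoidAlgebra.mapDomainRingHom R u]
  intro x
  change IsIntegral (AddMonoidAlgebra R Q) x
  induction x using AddMonoidAlgebra.induction_linear with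
  | zero => exact isIntegral_zero
  | add f g hf hg => exact hf.add hg
  | single p a =>
    obtain ⟨n, hn, q, hq⟩ := hu p
    refine IsIntegral.of_pow hn ?_
    rw [AddMonoidAlgebra.single_pow, ← hq]
    have h : algebraMap (AddMonoidAlgebra R Q) (AddMonoidAlgebra R P)
        (AddMonoidAlgebra.single q (a ^ n)) = AddMonoidAlgebra.single (u q) (a ^ n) :=
      AddMonoidAlgebra.mapDomain_single
    exact h ▸ isIntegral_algebraMap

/-- If `u : Q → P` is an injective homomorphism of commutative additive monoids of
Kummer type (every `p ∈ P` has a positive multiple in the image of `u`), then the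
induced ring homomorphism `ℤ[Q] → ℤ[P]` is injective and integral, and the induced
map `Spec ℤ[P] → Spec ℤ[Q]` is surjective. -/
theorem monoidAlgebra_spec_surjective_of_kummer {Q P : Type*}
    [AddCommMonoid Q] [AddCommMonoid P] (u : Q →+ P)
    (hu_inj : Function.Injective u)
    (hu : ∀ p : P, ∃ n : ℕ, 0 < n ∧ n • p ∈ Set.range u) :
    Function.Injective (AddMonoidAlgebra.mapDomainRingHom ℤ u) ∧
    (AddMonoidAlgebra.mapDomainRingHom ℤ u).IsIntegral ∧
    Function.Surjective (PrimeSpectrum.comap (AddMonoidAlgebra.mapDomainRingHom ℤ u)) := by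
  have hinj : Function.Injective (AddMonoidAlgebra.mapDomainRingHom ℤ u) :=
    AddMonoidAlgebra.mapDomain_injective hu_inj
  have hint := AddMonoidAlgebra.mapDomainRingHom_isIntegral_s2 (R := ℤ) u hu
  exact ⟨hinj, hint, hint.comap_surjective hinj⟩
end
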